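/- Assume E[(1 + |X|) · Λ(W,X)] < ∞. Then for every parameter θ the integrand defining Ȳ(θ) is integrable, Ȳ(θ) ≤ 0, and Ȳ(θ) = 0 if and only if, for every i ∈ I, ρ^i(X,θ) = ρ^i(X,θ*) holds almost everywhere with respect to the measure Λ(W,X)·dP (equivalently, P-almost everywhere on the event {W > 0}). -/

import Mathlib

open scoped BigOperators
open MeasureTheory

/-- Euclidean inner product on `ℝ^{j̄}`. -/
noncomputable def dot {n : ℕ} (x y : Fin n → ℝ) : ℝ := ∑ j, x j * y j

/-- Euclidean norm on `ℝ^{j̄}` (coordinates indexed by `Fin n`). -/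
noncomputable def normE {n : ℕ} (x : Fin n → ℝ) : ℝ := Real.sqrt (∑ j, (x j) ^ 2)

/-- The ratio (softmax) function `ρ^i(x,θ)` for a full parameter family
`θ : I → ℝ^{j̄}` (indices `I = {0,…,ī}`). -/
noncomputable def rho {ibar jbar : ℕ} (x : Fin jbar → ℝ)
    (θ : Fin (ibar + 1) → Fin jbar → ℝ) (i : Fin (ibar + 1)) : ℝ :=
  (∑ i', Real.exp (dot x (θ i' - θ i)))⁻¹

/-- Extend a parameter `θ = (θ^α)_{α∈I₀}` to `I = {0,…,ī}` by pinning `θ^0 = 0`. -/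
noncomputable def pad {ibar jbar : ℕ} (θ : Fin ibar → Fin jbar → ℝ) :
    Fin (ibar + 1) → Fin jbar → ℝ :=
  Fin.cases 0 θ

/-- `Λ(w,x) = w ∑_{i∈I} exp(x·ϑ^{*i})`. -/
noncomputable def Lam {ibar jbar : ℕ} (ϑs : Fin (ibar + 1) → Fin jbar → ℝ)
    (w : ℝ) (x : Fin jbar → ℝ) : ℝ :=
  w * ∑ i, Real.exp (dot x (ϑs i))

/-- `θ* = (ϑ^{*i} − ϑ^{*0})_{i∈I₀}`. -/
noncomputable def thetaStar {ibar jbar : ℕ} (ϑs : Fin (ibar + 1) → Fin jbar → ℝ) :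
    Fin ibar → Fin jbar → ℝ :=
  fun α => ϑs α.succ - ϑs 0

/-- The integrand of `Ȳ(θ)`:
`ω ↦ ∑_{i∈I} log(ρ^i(X,θ)/ρ^i(X,θ*)) ρ^i(X,θ*) Λ(W,X)`. -/
noncomputable def YbarInt {ibar jbar : ℕ} {Ω : Type*}
    (X : Ω → Fin jbar → ℝ) (W : Ω → ℝ) (ϑs : Fin (ibar + 1) → Fin jbar → ℝ)
    (θ : Fin ibar → Fin jbar → ℝ) (ω : Ω) : ℝ :=
  (∑ i : Fin (ibar + 1),
    Real.log (rho (X ω) (pad θ) i / rho (X ω) (pad (thetaStar ϑs)) i) *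
      rho (X ω) (pad (thetaStar ϑs)) i) * Lam ϑs (W ω) (X ω)

/-- `Ȳ(θ) = E[∑_{i∈I} log(ρ^i(X,θ)/ρ^i(X,θ*)) ρ^i(X,θ*) Λ(W,X)]`. -/
noncomputable def Ybar {ibar jbar : ℕ} {Ω : Type*} [MeasurableSpace Ω]
    (P : Measure Ω) (X : Ω → Fin jbar → ℝ) (W : Ω → ℝ)
    (ϑs : Fin (ibar + 1) → Fin jbar → ℝ) (θ : Fin ibar → Fin jbar → ℝ) : ℝ :=
  ∫ ω, YbarInt X W ϑs θ ω ∂P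

lemma aux_sum_pos {ibar jbar : ℕ} (x : Fin jbar → ℝ)
    (θ : Fin (ibar + 1) → Fin jbar → ℝ) (i : Fin (ibar + 1)) :
    1 ≤ ∑ i', Real.exp (dot x (θ i' - θ i)) := by
  have h := Finset.single_le_sum (f := fun i' => Real.exp (dot x (θ i' - θ i)))
    (fun j _ => (Real.exp_pos _).le) (Finset.mem_univ i)
  have h2 : Real.exp (dot x (θ i - θ i)) = 1 := by simp [dot]
  simp only [h2] at h
  exact h

lemma aux_rho_pos {ibar jbar : ℕ} (x : Fin jbar → ℝ)
    (θ : Fin (ibar + 1) → Fin jbar → ℝ) (i : Fin (ibar + 1)) : 0 < rho x θ i :=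
  inv_pos.2 (lt_of_lt_of_le one_pos (aux_sum_pos x θ i))

lemma aux_rho_le {ibar jbar : ℕ} (x : Fin jbar → ℝ)
    (θ : Fin (ibar + 1) → Fin jbar → ℝ) (i : Fin (ibar + 1)) : rho x θ i ≤ 1 :=
  inv_le_one_of_one_le₀ (aux_sum_pos x θ i)

lemma aux_dot_sub {n : ℕ} (x y z : Fin n → ℝ) : dot x (y - z) = dot x y - dot x z := by
  simp [dot, mul_sub, Finset.sum_sub_distrib]

lemma aux_rho_sum {ibar jbar : ℕ} (x : Fin jbar → ℝ)
    (θ : Fin (ibar + 1) → Fin jbar → ℝ) : ∑ i, rho x θ i = 1 := by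
  have hpos : 0 < ∑ i', Real.exp (dot x (θ i')) :=
    Finset.sum_pos (fun _ _ => Real.exp_pos _) Finset.univ_nonempty
  have h : ∀ i, rho x θ i = Real.exp (dot x (θ i)) / ∑ i', Real.exp (dot x (θ i')) := by
    intro i
    unfold rho
    simp only [aux_dot_sub, Real.exp_sub]
    rw [← Finset.sum_div, inv_div]
  simp only [h]
  rw [← Finset.sum_div, div_self hpos.ne']

lemma aux_normE_nonneg {n : ℕ} (x : Fin n → ℝ) : 0 ≤ normE x := Real.sqrt_nonneg _

lemma aux_log_bound {ibar jbar : ℕ} (θ : Fin (ibar + 1) → Fin jbar → ℝ) (i : Fin (ibar + 1)) :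
    ∃ C : ℝ, 0 ≤ C ∧ ∀ x : Fin jbar → ℝ, |Real.log (rho x θ i)| ≤ C * (1 + normE x) := by
  set K := ∑ i', normE (θ i' - θ i) with hK
  have hK0 : 0 ≤ K := Finset.sum_nonneg fun _ _ => aux_normE_nonneg _
  have hL0 : 0 ≤ Real.log ((ibar : ℝ) + 1) := Real.log_nonneg (by simp)
  refine ⟨Real.log ((ibar : ℝ) + 1) + K, by positivity, fun x => ?_⟩
  have h1 := aux_sum_pos x θ i
  have hx := aux_normE_nonneg x
  unfold rho
  rw [Real.log_inv, abs_neg, abs_of_nonneg (Real.log_nonneg h1)]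
  have h2 : ∑ i', Real.exp (dot x (θ i' - θ i)) ≤ ((ibar : ℝ) + 1) * Real.exp (normE x * K) := by
    calc _ ≤ ∑ i' : Fin (ibar + 1), Real.exp (normE x * K) := by
          refine Finset.sum_le_sum fun i' _ => Real.exp_le_exp.2 ?_
          refine (Real.sum_mul_le_sqrt_mul_sqrt Finset.univ x (θ i' - θ i)).trans ?_
          refine mul_le_mul_of_nonneg_left ?_ hx
          exact Finset.single_le_sum (f := fun i' => normE (θ i' - θ i))
            (fun j _ => aux_normE_nonneg _) (Finset.mem_univ i')
      _ = _ := by simp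
  have h3 := Real.log_le_log (lt_of_lt_of_le one_pos h1) h2
  rw [Real.log_mul (by positivity) (by positivity), Real.log_exp] at h3
  nlinarith [mul_nonneg hL0 hx]

lemma aux_term_le {p q : ℝ} (hp : 0 < p) (hq : 0 < q) : Real.log (p / q) * q ≤ p - q := by
  have := mul_le_mul_of_nonneg_right (Real.log_le_sub_one_of_pos (div_pos hp hq)) hq.le
  rwa [sub_mul, div_mul_cancel₀ _ hq.ne', one_mul] at this

lemma aux_term_lt {p q : ℝ} (hp : 0 < p) (hq : 0 < q) (h : p ≠ q) :
    Real.log (p / q) * q < p - q := by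
  have h1 : p / q ≠ 1 := fun h' => h ((div_eq_one_iff_eq hq.ne').1 h')
  have := mul_lt_mul_of_pos_right (Real.log_lt_sub_one_of_pos (div_pos hp hq) h1) hq
  rwa [sub_mul, div_mul_cancel₀ _ hq.ne', one_mul] at this

lemma aux_gibbs_le {n : ℕ} (p q : Fin n → ℝ) (hp : ∀ i, 0 < p i) (hq : ∀ i, 0 < q i)
    (hp1 : ∑ i, p i = 1) (hq1 : ∑ i, q i = 1) :
    ∑ i, Real.log (p i / q i) * q i ≤ 0 := by
  calc _ ≤ ∑ i, (p i - q i) := Finset.sum_le_sum fun i _ => aux_term_le (hp i) (hq i)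
    _ = 0 := by rw [Finset.sum_sub_distrib, hp1, hq1, sub_self]

lemma aux_gibbs_eq {n : ℕ} (p q : Fin n → ℝ) (hp : ∀ i, 0 < p i) (hq : ∀ i, 0 < q i)
    (hp1 : ∑ i, p i = 1) (hq1 : ∑ i, q i = 1) :
    ∑ i, Real.log (p i / q i) * q i = 0 ↔ ∀ i, p i = q i := by
  constructor
  · intro h
    by_contra! hne
    obtain ⟨i, hi⟩ := hne
    have : ∑ i, Real.log (p i / q i) * q i < ∑ i, (p i - q i) :=
      Finset.sum_lt_sum (fun i _ => aux_term_le (hp i) (hq i))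
        ⟨i, Finset.mem_univ i, aux_term_lt (hp i) (hq i) hi⟩
    rw [Finset.sum_sub_distrib, hp1, hq1, sub_self] at this
    exact absurd h this.ne
  · intro h
    refine Finset.sum_eq_zero fun i _ => ?_
    rw [h i, div_self (hq i).ne']
    simp

/-- if `E[(1 + |X|)·Λ(W,X)] < ∞`, then for every parameter `θ` the
integrand defining `Ȳ(θ)` is integrable, `Ȳ(θ) ≤ 0`, and `Ȳ(θ) = 0` if and only
if, for every `i ∈ I`, `ρ^i(X,θ) = ρ^i(X,θ*)` holds almost everywhere with
respect to the measure `Λ(W,X)·dP`. -/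
theorem statement8 (ibar jbar : ℕ) (hibar : 1 ≤ ibar) (hjbar : 1 ≤ jbar)
    {Ω : Type*} [MeasurableSpace Ω] (P : Measure Ω) [IsProbabilityMeasure P]
    (X : Ω → Fin jbar → ℝ) (W : Ω → ℝ)
    (hX : Measurable X) (hW : Measurable W) (hWpos : ∀ ω, 0 ≤ W ω)
    (ϑs : Fin (ibar + 1) → Fin jbar → ℝ)
    (hint : Integrable (fun ω => (1 + normE (X ω)) * Lam ϑs (W ω) (X ω)) P)
    (θ : Fin ibar → Fin jbar → ℝ) :
    Integrable (YbarInt X W ϑs θ) P ∧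
    Ybar P X W ϑs θ ≤ 0 ∧
    (Ybar P X W ϑs θ = 0 ↔
      ∀ i : Fin (ibar + 1),
        (fun ω => rho (X ω) (pad θ) i)
          =ᵐ[P.withDensity (fun ω => ENNReal.ofReal (Lam ϑs (W ω) (X ω)))]
        (fun ω => rho (X ω) (pad (thetaStar ϑs)) i)) := by
  have hLam0 : ∀ ω, 0 ≤ Lam ϑs (W ω) (X ω) := fun ω =>
    mul_nonneg (hWpos ω) (Finset.sum_nonneg fun _ _ => (Real.exp_pos _).le)
  have hXj : ∀ j, Measurable fun ω => X ω j := fun j => (measurable_pi_apply j).comp hX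
  have hdot : ∀ y : Fin jbar → ℝ, Measurable fun ω => dot (X ω) y := by
    intro y
    unfold dot
    exact Finset.measurable_sum _ fun j _ => (hXj j).mul_const _
  have hrho : ∀ (η : Fin (ibar + 1) → Fin jbar → ℝ) i, Measurable fun ω => rho (X ω) η i := by
    intro η i
    unfold rho
    exact (Finset.measurable_sum _ fun j _ => (hdot _).exp).inv
  have hLam : Measurable fun ω => Lam ϑs (W ω) (X ω) := by
    unfold Lam
    exact hW.mul (Finset.measurable_sum _ fun j _ => (hdot _).exp)
  have hYm : Measurable (YbarInt X W ϑs θ) := by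
    unfold YbarInt
    exact (Finset.measurable_sum _ fun i _ =>
      (((hrho _ i).div (hrho _ i)).log).mul (hrho _ i)).mul hLam
  choose C hC0 hC using aux_log_bound (pad θ)
  choose D hD0 hD using aux_log_bound (pad (thetaStar ϑs))
  have hI : Integrable (YbarInt X W ϑs θ) P := by
    refine Integrable.mono' (hint.const_mul (∑ i, (C i + D i))) hYm.aestronglyMeasurable
      (Filter.Eventually.of_forall fun ω => ?_)
    have hx := aux_normE_nonneg (X ω)
    unfold YbarInt
    rw [Real.norm_eq_abs, abs_mul, abs_of_nonneg (hLam0 ω), ← mul_assoc]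
    refine mul_le_mul_of_nonneg_right ?_ (hLam0 ω)
    rw [Finset.sum_mul]
    refine (Finset.abs_sum_le_sum_abs _ _).trans (Finset.sum_le_sum fun i _ => ?_)
    have hp := aux_rho_pos (X ω) (pad θ) i
    have hq := aux_rho_pos (X ω) (pad (thetaStar ϑs)) i
    have hq1 := aux_rho_le (X ω) (pad (thetaStar ϑs)) i
    rw [abs_mul, abs_of_pos hq, Real.log_div hp.ne' hq.ne']
    refine (mul_le_of_le_one_right (abs_nonneg _) hq1).trans ?_
    refine (abs_sub _ _).trans ?_
    have := hC i (X ω)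
    have := hD i (X ω)
    linarith
  have hle : ∀ ω, YbarInt X W ϑs θ ω ≤ 0 := fun ω =>
    mul_nonpos_of_nonpos_of_nonneg
      (aux_gibbs_le _ _ (aux_rho_pos _ _) (aux_rho_pos _ _) (aux_rho_sum _ _) (aux_rho_sum _ _))
      (hLam0 ω)
  refine ⟨hI, integral_nonpos hle, ?_⟩
  have h1 : Ybar P X W ϑs θ = 0 ↔ ∀ᵐ ω ∂P, YbarInt X W ϑs θ ω = 0 := by
    have h := integral_eq_zero_iff_of_nonneg (μ := P) (f := fun ω => - YbarInt X W ϑs θ ω)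
      (fun ω => neg_nonneg.2 (hle ω)) hI.neg
    rw [integral_neg, neg_eq_zero] at h
    refine h.trans (Filter.eventually_congr (Filter.Eventually.of_forall fun ω => ?_))
    simp
  rw [h1]
  simp only [Filter.EventuallyEq]
  rw [← ae_all_iff, ae_withDensity_iff hLam.ennreal_ofReal]
  refine Filter.eventually_congr (Filter.Eventually.of_forall fun ω => ?_)
  have hg := aux_gibbs_eq (rho (X ω) (pad θ)) (rho (X ω) (pad (thetaStar ϑs)))
    (aux_rho_pos _ _) (aux_rho_pos _ _) (aux_rho_sum _ _) (aux_rho_sum _ _)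
  rw [← hg]
  have h0 : ENNReal.ofReal (Lam ϑs (W ω) (X ω)) ≠ 0 ↔ Lam ϑs (W ω) (X ω) ≠ 0 := by
    rw [Ne, ENNReal.ofReal_eq_zero]
    exact not_congr ⟨fun h => le_antisymm h (hLam0 ω), fun h => h.le⟩
  rw [h0]
  unfold YbarInt
  rw [mul_eq_zero]
  tauto
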